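/- Let f(x) = ½‖A x^{m−1} − b‖² and s ∈ {1,…,n−1}. Let x* ∈ ℝⁿ with ‖x*‖₀ ≤ s, let T ⊆ {1,…,n} with |T| = s and supp(x*) ⊆ T, and suppose ∇_i f(x*) = 0 for all i ∈ T. Let x ∈ ℝⁿ be s-sparse, and assume: (i) there is m₀ > 0 with m₀·I ⪯ ∇²_T f(x); (ii) there is L > 0 with ‖∇²_{T,·} f(z) − ∇²_{T,·} f(w)‖ ≤ L‖z − w‖ (spectral norm of the s×n submatrix of the Hessian with rows indexed by T) for all z, w on the segment joining x* and x. Define x⁺ ∈ ℝⁿ by the full Newton step: ∇²_T f(x)·(x⁺_T − x_T) = ∇²_{T,T^c} f(x)·x_{T^c} − ∇_T f(x) and x⁺_{T^c} = 0. Then ‖x⁺ − x*‖ ≤ (L/(2m₀))·‖x − x*‖². -/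

import Mathlib

open scoped BigOperators RealInnerProductSpace

noncomputable section

/-- Contraction of an order-`m` tensor `A` on `{1,…,n}` with `m - d` copies of the vector `x`,
yielding an order-`d` tensor: the first `d` indices are free, the last `m - d` are summed
against copies of `x`. -/
def contra (m n : ℕ) (A : (Fin m → Fin n) → ℝ) (x : EuclideanSpace ℝ (Fin n))
    (d : ℕ) (hd : d ≤ m) : (Fin d → Fin n) → ℝ :=
  fun i => ∑ j : Fin (m - d) → Fin n,
    A (fun k => Fin.append i j (Fin.cast (by omega) k)) * ∏ l, x (j l)

/-- `A x^{m-1}` as a vector in `ℝⁿ`. -/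
def tvec (m n : ℕ) (A : (Fin m → Fin n) → ℝ) (x : EuclideanSpace ℝ (Fin n))
    (h : 1 ≤ m) : EuclideanSpace ℝ (Fin n) :=
  (EuclideanSpace.equiv (Fin n) ℝ).symm fun i => contra m n A x 1 h ![i]

/-- `A x^{m-2}` as an `n × n` matrix. -/
def tmat (m n : ℕ) (A : (Fin m → Fin n) → ℝ) (x : EuclideanSpace ℝ (Fin n))
    (h : 2 ≤ m) : Matrix (Fin n) (Fin n) ℝ :=
  Matrix.of fun i j => contra m n A x 2 h ![i, j]

/-- The least-squares objective `f(x) = ½ ‖A x^{m-1} - b‖²`. -/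
def obj (m n : ℕ) (A : (Fin m → Fin n) → ℝ) (b : EuclideanSpace ℝ (Fin n))
    (h : 1 ≤ m) : EuclideanSpace ℝ (Fin n) → ℝ :=
  fun x => (1 / 2) * ‖tvec m n A x h - b‖ ^ 2

/-- Frobenius norm of a tensor (indexed family of reals). -/
def frob {ι : Type*} [Fintype ι] (T : ι → ℝ) : ℝ :=
  Real.sqrt (∑ i, T i ^ 2)

/-- Hessian matrix of `f` at `x` via the second iterated Fréchet derivative. -/
def hess (n : ℕ) (f : EuclideanSpace ℝ (Fin n) → ℝ) (x : EuclideanSpace ℝ (Fin n)) :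
    Matrix (Fin n) (Fin n) ℝ :=
  Matrix.of fun i j =>
    iteratedFDeriv ℝ 2 f x ![EuclideanSpace.single i 1, EuclideanSpace.single j 1]

/-- Support of a vector. -/
def supp {n : ℕ} (x : EuclideanSpace ℝ (Fin n)) : Finset (Fin n) :=
  Finset.univ.filter fun i => x i ≠ 0

/-- `ℓ₀`-"norm": number of nonzero entries. -/
def spars {n : ℕ} (x : EuclideanSpace ℝ (Fin n)) : ℕ := (supp x).card

/-- Principal submatrix indexed by a finite index set `T`. -/
def subMat {n : ℕ} (M : Matrix (Fin n) (Fin n) ℝ) (T : Finset (Fin n)) :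
    Matrix {i // i ∈ T} {i // i ∈ T} ℝ :=
  Matrix.of fun i j => M i.1 j.1

/-- Spectral norm of a (possibly rectangular) real matrix, i.e. the operator norm of the
induced map between Euclidean spaces. -/
def specNorm {α β : Type*} [Fintype α] [Fintype β] [DecidableEq β] (M : Matrix α β ℝ) : ℝ :=
  ‖LinearMap.toContinuousLinearMap (Matrix.toEuclideanLin M)‖

/-- Membership `z ∈ P_s(u)` for the hard-thresholding projection. -/
def inProj {n : ℕ} (s : ℕ) (u z : EuclideanSpace ℝ (Fin n)) : Prop :=
  spars z ≤ s ∧ ∀ w : EuclideanSpace ℝ (Fin n), spars w ≤ s → ‖u - z‖ ≤ ‖u - w‖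

/-- Membership `T ∈ 𝒯(x;η)`: `T` collects `s` indices of largest-magnitude entries of
`u = x - η ∇f(x)`. -/
def Tmem {n : ℕ} (f : EuclideanSpace ℝ (Fin n) → ℝ) (s : ℕ) (η : ℝ)
    (x : EuclideanSpace ℝ (Fin n)) (T : Finset (Fin n)) : Prop :=
  T.card = s ∧ ∀ i ∈ T, ∀ j ∉ T,
    |(x - η • gradient f x) j| ≤ |(x - η • gradient f x) i|

theorem contDiff_obj (m n : ℕ) (A : (Fin m → Fin n) → ℝ) (b : EuclideanSpace ℝ (Fin n))
    (h : 1 ≤ m) {k : WithTop ℕ∞} : ContDiff ℝ k (obj m n A b h) := by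
  have hcoord (i : Fin n) : ContDiff ℝ k fun x : EuclideanSpace ℝ (Fin n) => x i := by
    fun_prop
  have hvec : ContDiff ℝ k fun x => tvec m n A x h := by
    refine (EuclideanSpace.equiv (Fin n) ℝ).symm.contDiff.comp (contDiff_pi.2 fun i => ?_)
    exact ContDiff.sum fun j _ => contDiff_const.mul (contDiff_prod fun l _ => hcoord _)
  exact contDiff_const.mul ((hvec.sub contDiff_const).norm_sq ℝ)

theorem EuclideanSpace.eq_sum_smul_single {n : ℕ} (u : EuclideanSpace ℝ (Fin n)) :
    u = ∑ i, u i • EuclideanSpace.single i (1 : ℝ) := by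
  simpa using ((EuclideanSpace.basisFun (Fin n) ℝ).sum_repr u).symm

theorem fderiv_fderiv_apply_eq_sum_hess {n : ℕ} {f : EuclideanSpace ℝ (Fin n) → ℝ}
    (hf : ContDiff ℝ 2 f) (x u v : EuclideanSpace ℝ (Fin n)) :
    fderiv ℝ (fderiv ℝ f) x v u = ∑ i, u i * ∑ j, hess n f x i j * v j := by
  have hsymm : IsSymmSndFDerivAt ℝ f x :=
    hf.contDiffAt.isSymmSndFDerivAt (by simp)
  rw [hsymm v u]
  conv_lhs => rw [u.eq_sum_smul_single, v.eq_sum_smul_single]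
  simp only [map_sum, map_smul, sum_apply, smul_apply,
    smul_eq_mul, hess, Matrix.of_apply, iteratedFDeriv_two_apply, Finset.mul_sum,
    Matrix.cons_val_zero, Matrix.cons_val_one]
  rw [Finset.sum_comm]
  refine Finset.sum_congr rfl fun i _ => Finset.sum_congr rfl fun j _ => ?_
  ring

theorem fderiv_apply_eq_sum_gradient {n : ℕ} (f : EuclideanSpace ℝ (Fin n) → ℝ)
    (x u : EuclideanSpace ℝ (Fin n)) :
    fderiv ℝ f x u = ∑ i, u i * gradient f x i := by
  have h : fderiv ℝ f x u = inner ℝ (gradient f x) u := by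
    simp [gradient]
  rw [h, PiLp.inner_apply]
  simp

/-- First-order Taylor estimate at the endpoint `1`, with a one-sided Lipschitz derivative. -/
theorem deriv_sub_increment_le {φ φ' : ℝ → ℝ} {C : ℝ}
    (hφ : ∀ t, HasDerivAt φ (φ' t) t)
    (hC : ∀ t ∈ Set.Icc (0 : ℝ) 1, φ' 1 - φ' t ≤ C * (1 - t)) :
    φ' 1 - (φ 1 - φ 0) ≤ C / 2 := by
  let ψ : ℝ → ℝ := fun t => t * φ' 1 - φ t - C * (t - t ^ 2 / 2)
  have hψ (t : ℝ) : HasDerivAt ψ (φ' 1 - φ' t - C * (1 - t)) t := by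
    have h := (((hasDerivAt_id t).mul_const (φ' 1)).sub (hφ t)).sub
      (((hasDerivAt_id t).sub (((hasDerivAt_id t).pow 2).div_const 2)).const_mul C)
    refine h.congr_deriv ?_
    simp
  have hanti : AntitoneOn ψ (Set.Icc 0 1) := by
    refine antitoneOn_of_deriv_nonpos (convex_Icc 0 1)
      (fun t _ => (hψ t).continuousAt.continuousWithinAt)
      (fun t _ => (hψ t).differentiableAt.differentiableWithinAt) fun t ht => ?_
    rw [(hψ t).deriv]
    linarith [hC t (interior_subset ht)]
  have h := hanti (Set.left_mem_Icc.2 zero_le_one) (Set.right_mem_Icc.2 zero_le_one) zero_le_one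
  simp only [ψ] at h
  linarith

theorem norm_toLp_restrict_le {n : ℕ} (T : Finset (Fin n)) (u : EuclideanSpace ℝ (Fin n)) :
    ‖WithLp.toLp 2 fun i : {i // i ∈ T} => u i.1‖ ≤ ‖u‖ := by
  rw [EuclideanSpace.norm_eq, EuclideanSpace.norm_eq]
  refine Real.sqrt_le_sqrt ?_
  rw [Finset.sum_coe_sort T fun i => ‖u i‖ ^ 2]
  exact Finset.sum_le_sum_of_subset_of_nonneg (Finset.subset_univ T) fun _ _ _ => by positivity

theorem sum_mul_mulVec_le_specNorm {n : ℕ} (T : Finset (Fin n))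
    (M : Matrix {i // i ∈ T} (Fin n) ℝ) (u v : EuclideanSpace ℝ (Fin n)) :
    ∑ i : {i // i ∈ T}, u i.1 * ∑ j, M i j * v j ≤ specNorm M * ‖v‖ * ‖u‖ := by
  let uT : EuclideanSpace ℝ {i // i ∈ T} := WithLp.toLp 2 fun i => u i.1
  have hinner : ∑ i : {i // i ∈ T}, u i.1 * ∑ j, M i j * v j
      = inner ℝ (Matrix.toEuclideanLin M v) uT := by
    simp [PiLp.inner_apply, uT, Matrix.mulVec, dotProduct]
  rw [hinner]
  refine (real_inner_le_norm _ _).trans ?_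
  refine mul_le_mul ?_ (norm_toLp_restrict_le T u) (norm_nonneg _)
    (mul_nonneg (norm_nonneg _) (norm_nonneg _))
  exact (LinearMap.toContinuousLinearMap (Matrix.toEuclideanLin M)).le_opNorm v

/-- quadratic error bound for the full restricted Newton step: if
`∇_T f(x*) = 0` on `T ⊇ supp(x*)` with `|T| = s`, `m₀·I ⪯ ∇²_T f(x)`, and the `T`-row
submatrix of the Hessian is `L`-Lipschitz (in spectral norm) on the segment joining `x*`
and `x`, then the Newton iterate `x⁺` satisfies `‖x⁺ - x*‖ ≤ (L/(2m₀))‖x - x*‖²`. -/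
theorem newton_quadratic_step (m n : ℕ) (hm : 3 ≤ m) (hn : 1 ≤ n)
    (A : (Fin m → Fin n) → ℝ)
    (hA : ∀ (σ : Equiv.Perm (Fin m)) (i : Fin m → Fin n), A (i ∘ σ) = A i)
    (b : EuclideanSpace ℝ (Fin n))
    (s : ℕ) (hs1 : 1 ≤ s) (hs2 : s < n)
    (xs : EuclideanSpace ℝ (Fin n)) (hxs : spars xs ≤ s)
    (T : Finset (Fin n)) (hTcard : T.card = s) (hTsupp : supp xs ⊆ T)
    (hgrad : ∀ i ∈ T, gradient (obj m n A b (by omega)) xs i = 0)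
    (x : EuclideanSpace ℝ (Fin n)) (hx : spars x ≤ s)
    (m₀ : ℝ) (hm₀ : 0 < m₀)
    (hpos : (subMat (hess n (obj m n A b (by omega)) x) T - m₀ • 1).PosSemidef)
    (L : ℝ) (hL : 0 < L)
    (hlip : ∀ z w : EuclideanSpace ℝ (Fin n),
      z ∈ segment ℝ xs x → w ∈ segment ℝ xs x →
      specNorm (Matrix.of fun (i : {i // i ∈ T}) (j : Fin n) =>
          hess n (obj m n A b (by omega)) z i.1 j
            - hess n (obj m n A b (by omega)) w i.1 j)
        ≤ L * ‖z - w‖)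
    (xp : EuclideanSpace ℝ (Fin n))
    (hxp1 : ∀ i ∈ T, ∑ j ∈ T, hess n (obj m n A b (by omega)) x i j * (xp j - x j) =
      (∑ j ∈ Tᶜ, hess n (obj m n A b (by omega)) x i j * x j)
        - gradient (obj m n A b (by omega)) x i)
    (hxp2 : ∀ j ∉ T, xp j = 0) :
    ‖xp - xs‖ ≤ (L / (2 * m₀)) * ‖x - xs‖ ^ 2 := by
  set f := obj m n A b (by omega) with hfdef
  have hf : ContDiff ℝ 2 f := contDiff_obj m n A b _
  set d := xp - xs with hd
  set v := x - xs with hv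
  have hd0 : ∀ i ∉ T, d i = 0 := by
    intro i hi
    have hxsi : xs i = 0 := by
      by_contra hne
      exact hi (hTsupp (by simp [supp, hne]))
    simp [hd, hxp2 i hi, hxsi]
  have hsumT (g : Fin n → ℝ) : ∑ i, d i * g i = ∑ i ∈ T, d i * g i :=
    (Finset.sum_subset (Finset.subset_univ T) fun i _ hi => by simp [hd0 i hi]).symm
  have hcurv : m₀ * ‖d‖ ^ 2 ≤ ∑ i ∈ T, d i * ∑ j, hess n f x i j * d j := by
    have h := hpos.dotProduct_mulVec_nonneg fun i => d i.1
    have hnorm : ‖d‖ ^ 2 = ∑ i ∈ T, d i * d i := by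
      rw [EuclideanSpace.real_norm_sq_eq, ← hsumT]
      simp [sq]
    have hrow (i : Fin n) : ∑ j, hess n f x i j * d j = ∑ j ∈ T, hess n f x i j * d j :=
      (Finset.sum_subset (Finset.subset_univ T) fun j _ hj => by simp [hd0 j hj]).symm
    have hexp : (star fun i : {i // i ∈ T} => d i.1) ⬝ᵥ
        ((subMat (hess n f x) T - m₀ • 1).mulVec fun i => d i.1)
        = (∑ i ∈ T, d i * ∑ j ∈ T, hess n f x i j * d j) - m₀ * ∑ i ∈ T, d i * d i := by
      rw [Matrix.sub_mulVec, dotProduct_sub, Matrix.smul_mulVec, Matrix.one_mulVec,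
        dotProduct_smul, smul_eq_mul]
      simp only [dotProduct, Matrix.mulVec, subMat, Matrix.of_apply, star_trivial]
      simp only [← Finset.sum_coe_sort T]
    rw [hexp] at h
    simp only [hrow, hnorm]
    linarith
  have hstep : ∀ i ∈ T, ∑ j, hess n f x i j * d j
      = (∑ j, hess n f x i j * v j) - gradient f x i := by
    intro i hi
    have h := hxp1 i hi
    have hsub : ∑ j, hess n f x i j * d j - ∑ j, hess n f x i j * v j
        = ∑ j, hess n f x i j * (xp j - x j) := by
      rw [← Finset.sum_sub_distrib]
      refine Finset.sum_congr rfl fun j _ => ?_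
      simp only [hd, hv, PiLp.sub_apply]
      ring
    have hcompl : ∑ j ∈ Tᶜ, hess n f x i j * (xp j - x j)
        = -∑ j ∈ Tᶜ, hess n f x i j * x j := by
      rw [← Finset.sum_neg_distrib]
      refine Finset.sum_congr rfl fun j hj => ?_
      rw [hxp2 j (Finset.mem_compl.1 hj)]
      ring
    rw [← Finset.sum_add_sum_compl T fun j => hess n f x i j * (xp j - x j), hcompl, h] at hsub
    linarith
  let γ : ℝ → EuclideanSpace ℝ (Fin n) := fun t => xs + t • v
  have hγ1 : γ 1 = x := by simp [γ, hv]
  have hγ0 : γ 0 = xs := by simp [γ]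
  have hγd (t : ℝ) : HasDerivAt γ v t := by
    simpa [γ] using ((hasDerivAt_id t).smul_const v).const_add xs
  have hγseg : ∀ t ∈ Set.Icc (0 : ℝ) 1, γ t ∈ segment ℝ xs x := fun t ht => by
    rw [segment_eq_image']
    exact ⟨t, ht, rfl⟩
  have hdf : Differentiable ℝ (fderiv ℝ f) :=
    (hf.fderiv_right (m := 1) (by norm_num)).differentiable (by norm_num)
  have hφ (t : ℝ) : HasDerivAt (fun t => fderiv ℝ f (γ t) d)
      (fderiv ℝ (fderiv ℝ f) (γ t) v d) t :=
    (ContinuousLinearMap.apply ℝ ℝ d).hasFDerivAt.comp_hasDerivAt t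
      ((hdf (γ t)).hasFDerivAt.comp_hasDerivAt t (hγd t))
  have hbound : ∀ t ∈ Set.Icc (0 : ℝ) 1,
      fderiv ℝ (fderiv ℝ f) (γ 1) v d - fderiv ℝ (fderiv ℝ f) (γ t) v d
        ≤ L * ‖v‖ ^ 2 * ‖d‖ * (1 - t) := by
    intro t ht
    have hop := sum_mul_mulVec_le_specNorm T (Matrix.of fun (i : {i // i ∈ T}) (j : Fin n) =>
      hess n f (γ 1) i.1 j - hess n f (γ t) i.1 j) d v
    have hl := hlip (γ 1) (γ t) (hγseg 1 (by simp)) (hγseg t ht)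
    have hdist : ‖γ 1 - γ t‖ = (1 - t) * ‖v‖ := by
      have : γ 1 - γ t = (1 - t) • v := by simp only [γ]; module
      rw [this, norm_smul, Real.norm_of_nonneg (by linarith [ht.2])]
    rw [hdist] at hl
    rw [fderiv_fderiv_apply_eq_sum_hess hf, fderiv_fderiv_apply_eq_sum_hess hf, hsumT, hsumT,
      ← Finset.sum_sub_distrib, ← Finset.sum_coe_sort T]
    simp only [Matrix.of_apply, sub_mul, Finset.sum_sub_distrib, mul_sub] at hop ⊢
    refine hop.trans ?_
    calc _ ≤ L * ((1 - t) * ‖v‖) * ‖v‖ * ‖d‖ := by gcongr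
      _ = _ := by ring
  have htaylor := deriv_sub_increment_le hφ hbound
  have hφ0 : fderiv ℝ f (γ 0) d = 0 := by
    rw [hγ0, fderiv_apply_eq_sum_gradient, hsumT]
    exact Finset.sum_eq_zero fun i hi => by rw [hgrad i hi, mul_zero]
  rw [hφ0, sub_zero, hγ1, fderiv_apply_eq_sum_gradient, fderiv_fderiv_apply_eq_sum_hess hf,
    hsumT, hsumT, ← Finset.sum_sub_distrib] at htaylor
  have hkey : m₀ * ‖d‖ ^ 2 ≤ L * ‖v‖ ^ 2 * ‖d‖ / 2 := by
    refine hcurv.trans (le_trans (le_of_eq ?_) htaylor)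
    refine Finset.sum_congr rfl fun i hi => ?_
    rw [hstep i hi, mul_sub]
  rcases (norm_nonneg d).eq_or_lt with h0 | hpos'
  · rw [← h0]
    positivity
  · rw [div_mul_eq_mul_div, le_div_iff₀ (by positivity)]
    nlinarith
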